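/- Let q ≥ 2 be an integer and let n be a positive integer coprime to q. Set m = ord_n(q), n₀ = gcd(n, q − 1), n₁ = n/n₀, and m₁ = ord_{n₁}(q). If m₁ < m, then, setting n' = gcd(n, q^{m₁} − 1) and k = n/n', one has k ≥ 2, n = n'·k, ord_{n'}(q) = m₁, and m = k·m₁; in other words, the triple (n, n', k) satisfies n = n'·k, k ≥ 2 and ord_n(q) = k · ord_{n'}(q). (The arithmetic content of Lemma 5.1(2), lem_ordbarpsi(2).) -/

import Mathlib

/-- The multiplicative order of `q` modulo `N`: the least positive integer `i`
such that `N` divides `q ^ i - 1`. -/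
noncomputable def multOrd (q N : ℕ) : ℕ := sInf {i : ℕ | 0 < i ∧ N ∣ q ^ i - 1}

theorem dvd_pow_sub_one_iff_cast_pow_eq_one {q : ℕ} (hq : 0 < q) (N i : ℕ) :
    N ∣ q ^ i - 1 ↔ (q : ZMod N) ^ i = 1 := by
  rw [← ZMod.natCast_eq_zero_iff, Nat.cast_sub (Nat.one_le_pow _ _ hq), sub_eq_zero]
  push_cast
  rfl

theorem orderOf_natCast_zmod_pos {q N : ℕ} (hN : 0 < N) (hco : Nat.Coprime q N) :
    0 < orderOf (q : ZMod N) := by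
  have : NeZero N := ⟨hN.ne'⟩
  rw [← ZMod.coe_unitOfCoprime q hco, orderOf_units]
  exact orderOf_pos _

theorem multOrd_eq_orderOf {q N : ℕ} (hq : 0 < q) (hN : 0 < N) (hco : Nat.Coprime q N) :
    multOrd q N = orderOf (q : ZMod N) := by
  have hmem : orderOf (q : ZMod N) ∈ {i : ℕ | 0 < i ∧ N ∣ q ^ i - 1} :=
    ⟨orderOf_natCast_zmod_pos hN hco,
      (dvd_pow_sub_one_iff_cast_pow_eq_one hq N _).2 (pow_orderOf_eq_one _)⟩
  refine le_antisymm (Nat.sInf_le hmem) (le_csInf ⟨_, hmem⟩ ?_)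
  rintro i ⟨hi, h⟩
  exact orderOf_le_of_pow_eq_one hi ((dvd_pow_sub_one_iff_cast_pow_eq_one hq N i).1 h)

theorem multOrd_pos {q N : ℕ} (hq : 0 < q) (hN : 0 < N) (hco : Nat.Coprime q N) :
    0 < multOrd q N :=
  multOrd_eq_orderOf hq hN hco ▸ orderOf_natCast_zmod_pos hN hco

theorem multOrd_dvd_iff {q N : ℕ} (hq : 0 < q) (hN : 0 < N) (hco : Nat.Coprime q N) (i : ℕ) :
    multOrd q N ∣ i ↔ N ∣ q ^ i - 1 := by
  rw [multOrd_eq_orderOf hq hN hco, orderOf_dvd_iff_pow_eq_one,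
    dvd_pow_sub_one_iff_cast_pow_eq_one hq]

theorem add_one_pow_modEq_of_dvd_sq {n d : ℕ} (h : n ∣ d ^ 2) (j : ℕ) :
    (d + 1) ^ j ≡ j * d + 1 [MOD n] := by
  induction j with
  | zero => simp [Nat.ModEq.refl]
  | succ j ih =>
    have hz : j * d ^ 2 ≡ 0 [MOD n] := (Nat.modEq_zero_iff_dvd).2 (h.mul_left j)
    calc (d + 1) ^ (j + 1) = (d + 1) ^ j * (d + 1) := pow_succ _ _
      _ ≡ (j * d + 1) * (d + 1) [MOD n] := ih.mul_right _
      _ = j * d ^ 2 + ((j + 1) * d + 1) := by ring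
      _ ≡ 0 + ((j + 1) * d + 1) [MOD n] := hz.add_right _
      _ = (j + 1) * d + 1 := by ring

theorem dvd_add_one_pow_sub_one_iff {n d : ℕ} (hn : 0 < n) (h : n ∣ d ^ 2) (j : ℕ) :
    n ∣ (d + 1) ^ j - 1 ↔ n / Nat.gcd n d ∣ j := by
  have hg : 0 < Nat.gcd n d := Nat.gcd_pos_of_pos_left d hn
  have hmod := add_one_pow_modEq_of_dvd_sq h j
  rw [← Nat.modEq_iff_dvd' (Nat.one_le_pow _ _ d.succ_pos)]
  have key : 1 ≡ (d + 1) ^ j [MOD n] ↔ n ∣ j * d := by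
    rw [← Nat.add_sub_cancel (n := j * d) (m := 1), ← Nat.modEq_iff_dvd' (by omega)]
    exact ⟨fun e => e.trans hmod, fun e => e.trans hmod.symm⟩
  rw [key]
  constructor
  · intro hd
    refine (Nat.coprime_div_gcd_div_gcd hg).dvd_of_dvd_mul_right ?_
    rw [← Nat.mul_div_assoc _ (Nat.gcd_dvd_right n d)]
    exact Nat.div_dvd_div (Nat.gcd_dvd_left n d) hd
  · intro hd
    have := mul_dvd_mul hd (Nat.gcd_dvd_right n d)
    rwa [Nat.div_mul_cancel (Nat.gcd_dvd_left n d)] at this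

/-- arithmetic content of Lemma 5.1(2), lem_ordbarpsi(2): with
`m = ord_n(q)`, `n₀ = gcd(n, q - 1)`, `n₁ = n / n₀`, `m₁ = ord_{n₁}(q)`, if
`m₁ < m`, then setting `n' = gcd(n, q^{m₁} - 1)` and `k = n / n'`, one has
`k ≥ 2`, `n = n'·k`, `ord_{n'}(q) = m₁`, and `m = k·m₁`. -/
theorem stmt10 (q n : ℕ) (hq : 2 ≤ q) (hn : 0 < n) (hco : Nat.gcd n q = 1)
    (m n₀ n₁ m₁ : ℕ) (hm : m = multOrd q n) (hn₀ : n₀ = Nat.gcd n (q - 1))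
    (hn₁ : n₁ = n / n₀) (hm₁ : m₁ = multOrd q n₁) (hlt : m₁ < m)
    (n' k : ℕ) (hn' : n' = Nat.gcd n (q ^ m₁ - 1)) (hk : k = n / n') :
    2 ≤ k ∧ n = n' * k ∧ multOrd q n' = m₁ ∧ m = k * m₁ := by
  have hq0 : 0 < q := by omega
  have hco' : Nat.Coprime q n := Nat.Coprime.symm hco
  have hn₀n : n₀ ∣ n := hn₀ ▸ Nat.gcd_dvd_left _ _
  have hmul : n₁ * n₀ = n := hn₁ ▸ Nat.div_mul_cancel hn₀n
  have hn₁n : n₁ ∣ n := ⟨n₀, hmul.symm⟩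
  have hn₁pos : 0 < n₁ := Nat.pos_of_dvd_of_pos hn₁n hn
  have hco₁ : Nat.Coprime q n₁ := hco'.coprime_dvd_right hn₁n
  have hm₁pos : 0 < m₁ := hm₁ ▸ multOrd_pos hq0 hn₁pos hco₁
  have hn₁d : n₁ ∣ q ^ m₁ - 1 := (multOrd_dvd_iff hq0 hn₁pos hco₁ m₁).1 (hm₁ ▸ dvd_rfl)
  have hn₀d : n₀ ∣ q ^ m₁ - 1 := by
    have h : q - 1 ∣ q ^ m₁ - 1 := by simpa using Nat.sub_dvd_pow_sub_pow q 1 m₁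
    exact (hn₀ ▸ Nat.gcd_dvd_right n (q - 1)).trans h
  have hsq : n ∣ (q ^ m₁ - 1) ^ 2 := by
    rw [← hmul, sq]
    exact mul_dvd_mul hn₁d hn₀d
  have hn'n : n' ∣ n := hn' ▸ Nat.gcd_dvd_left _ _
  have hn'd : n' ∣ q ^ m₁ - 1 := hn' ▸ Nat.gcd_dvd_right _ _
  have hn₁n' : n₁ ∣ n' := hn' ▸ Nat.dvd_gcd hn₁n hn₁d
  have hn'pos : 0 < n' := Nat.pos_of_dvd_of_pos hn'n hn
  have hco₂ : Nat.Coprime q n' := hco'.coprime_dvd_right hn'n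
  have hnk : n = n' * k := hk ▸ (Nat.mul_div_cancel' hn'n).symm
  have hord' : multOrd q n' = m₁ := by
    refine Nat.dvd_antisymm ((multOrd_dvd_iff hq0 hn'pos hco₂ _).2 hn'd) ?_
    rw [hm₁, multOrd_dvd_iff hq0 hn₁pos hco₁]
    exact hn₁n'.trans ((multOrd_dvd_iff hq0 hn'pos hco₂ _).1 dvd_rfl)
  have hpow (j : ℕ) : m ∣ m₁ * j ↔ k ∣ j := by
    rw [hm, multOrd_dvd_iff hq0 hn hco', pow_mul, hk, hn', ← dvd_add_one_pow_sub_one_iff hn hsq,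
      Nat.sub_add_cancel (Nat.one_le_pow _ _ hq0)]
  obtain ⟨c, hc⟩ : m₁ ∣ m := by
    rw [← hord', multOrd_dvd_iff hq0 hn'pos hco₂]
    exact hn'n.trans ((multOrd_dvd_iff hq0 hn hco' _).1 (hm ▸ dvd_rfl))
  have hck : c = k := by
    refine Nat.dvd_antisymm ?_ ((hpow c).1 (hc ▸ dvd_rfl))
    have h := (hpow k).2 dvd_rfl
    rw [hc] at h
    exact Nat.dvd_of_mul_dvd_mul_left hm₁pos h
  have hmk : m = k * m₁ := by rw [hc, hck, mul_comm]
  refine ⟨?_, hnk, hord', hmk⟩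
  by_contra! hlt2
  have : k * m₁ ≤ 1 * m₁ := Nat.mul_le_mul_right _ (by omega)
  omega
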